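/- Let n be a positive even integer, let 0 < m < n−1 and let t be an integer with −n < t < n−1. Let N_{(t,m)} denote the number of (t,m)-pairs in M_n, let S_{(t,m)} denote the number of (t,m)-simplices in M_n, let L_{(t,m+1)} denote the number of ways a fixed (t,m+1)-pair occurs as a connecting line of a (t,m)-simplex (this number is independent of the chosen pair), and let K_{(t+1,m)} denote the number of ways a fixed (t+1,m)-pair occurs as an edge of a (t,m)-simplex (also independent of the chosen pair). Then S_{(t,m)}·n(n−1) = N_{(t+1,m)}·K_{(t+1,m)}, S_{(t,m)}·n² = N_{(t,m+1)}·L_{(t,m+1)}, and consequently L_{(t,m+1)}·(n−1)·N_{(t,m+1)} = K_{(t+1,m)}·n·N_{(t+1,m)}. -/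

import Mathlib

/-!
Counting identities for `(t,m)`-simplices in `M_n` (equation (2.1) of the paper).

Pairs `{x,y}` and simplices `(𝒳,𝒴)` are unordered (`{x,y} = {y,x}` and
`(𝒳,𝒴) = (𝒴,𝒳)`), so both are modelled by `Sym2`.  Occurrence counts of a fixed
pair as an edge (resp. connecting line) of a `(t,m)`-simplex are counts of ordered
occurrences, over all `(t,m)`-simplices.
-/

/-- The cyclic metric with period `n^n`. -/
noncomputable def cyclicDist (n : ℕ) (a b : ℝ) : ℝ :=
  min |a - b| ((n : ℝ) ^ n - |a - b|)

/-- The set `L_n = {k·n^{-n} : 1 ≤ k ≤ n^{2n}}`. -/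
def Ln (n : ℕ) : Set ℝ :=
  {a | ∃ k : ℕ, 1 ≤ k ∧ k ≤ n ^ (2 * n) ∧ a = (k : ℝ) / (n : ℝ) ^ n}

/-- The set `M_n`, the product of `n^n` copies of `L_n`. -/
def Mn (n : ℕ) : Set (Fin (n ^ n) → ℝ) := {x | ∀ i, x i ∈ Ln n}

/-- `{x, y}` is a `(t,m)`-pair in `M_n`. -/
def IsPair (n : ℕ) (t : ℤ) (m : ℕ) (x y : Fin (n ^ n) → ℝ) : Prop :=
  x ∈ Mn n ∧ y ∈ Mn n ∧
    (∀ i, x i ≠ y i → cyclicDist n (x i) (y i) = (2 : ℝ) ^ t) ∧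
    Set.ncard {i | x i ≠ y i} = n ^ m

/-- `(X, Y)` is a `(t,m)`-simplex in `M_n`. -/
def IsSimplex (n : ℕ) (t : ℤ) (m : ℕ) (X Y : Fin n → Fin (n ^ n) → ℝ) : Prop :=
  (∀ i j, IsPair n t (m + 1) (X i) (Y j)) ∧
    (∀ i j, i ≠ j → IsPair n (t + 1) m (X i) (X j)) ∧
    (∀ i j, i ≠ j → IsPair n (t + 1) m (Y i) (Y j))

/-- `N_{(t,m)}`: the number of (unordered) `(t,m)`-pairs in `M_n`. -/
noncomputable def pairCount (n : ℕ) (t : ℤ) (m : ℕ) : ℕ :=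
  Set.ncard {σ : Sym2 (Fin (n ^ n) → ℝ) | ∃ x y, σ = s(x, y) ∧ IsPair n t m x y}

/-- `S_{(t,m)}`: the number of (unordered) `(t,m)`-simplices in `M_n`. -/
noncomputable def simplexCount (n : ℕ) (t : ℤ) (m : ℕ) : ℕ :=
  Set.ncard {σ : Sym2 (Fin n → Fin (n ^ n) → ℝ) | ∃ X Y, σ = s(X, Y) ∧ IsSimplex n t m X Y}

/-- The number of ordered occurrences of the pair `{x,y}` (with the orientation `(x,y)`)
as an edge, over all `(t,m)`-simplices of `M_n`. -/
noncomputable def edgeOccCount (n : ℕ) (t : ℤ) (m : ℕ) (x y : Fin (n ^ n) → ℝ) : ℕ :=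
  Set.ncard {q : Sym2 (Fin n → Fin (n ^ n) → ℝ) × Fin n × Fin n |
    q.2.1 ≠ q.2.2 ∧ ∃ X Y, q.1 = s(X, Y) ∧ IsSimplex n t m X Y ∧
      ((X q.2.1 = x ∧ X q.2.2 = y) ∨ (Y q.2.1 = x ∧ Y q.2.2 = y))}

/-- The number of ordered occurrences of the pair `{x,y}` (with the orientation `(x,y)`)
as a connecting line, over all `(t,m)`-simplices of `M_n`. -/
noncomputable def lineOccCount (n : ℕ) (t : ℤ) (m : ℕ) (x y : Fin (n ^ n) → ℝ) : ℕ :=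
  Set.ncard {q : Sym2 (Fin n → Fin (n ^ n) → ℝ) × Fin n × Fin n |
    ∃ X Y, q.1 = s(X, Y) ∧ IsSimplex n t m X Y ∧ X q.2.1 = x ∧ Y q.2.2 = y}

section

open Set

/-- A map between finite sets all of whose fibers have `k` elements. -/
lemma ncard_eq_ncard_mul_of_fiber {α β : Type*} {s : Set α} {t : Set β} (f : α → β) (k : ℕ)
    (hs : s.Finite) (ht : t.Finite) (hf : MapsTo f s t)
    (hk : ∀ b ∈ t, {a | a ∈ s ∧ f a = b}.ncard = k) : s.ncard = t.ncard * k := by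
  classical
  lift s to Finset α using hs
  lift t to Finset β using ht
  rw [ncard_coe_finset, ncard_coe_finset, Finset.card_eq_sum_card_fiberwise hf,
    ← smul_eq_mul, ← Finset.sum_const]
  refine Finset.sum_congr rfl fun b hb ↦ ?_
  rw [← hk b hb, ← ncard_coe_finset]
  simp

/-- A symmetric irreflexive relation has twice as many ordered pairs as unordered ones. -/
lemma ncard_ordered_eq_two_mul {α : Type*} {R : α → α → Prop}
    (hfin : {p : α × α | R p.1 p.2}.Finite) (hsymm : ∀ x y, R x y → R y x)
    (hirr : ∀ x, ¬ R x x) :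
    {p : α × α | R p.1 p.2}.ncard = {σ : Sym2 α | ∃ x y, σ = s(x, y) ∧ R x y}.ncard * 2 := by
  have himage : {σ : Sym2 α | ∃ x y, σ = s(x, y) ∧ R x y} =
      (fun p : α × α ↦ s(p.1, p.2)) '' {p : α × α | R p.1 p.2} := by
    ext σ
    simp [eq_comm, and_comm]
  refine ncard_eq_ncard_mul_of_fiber (fun p ↦ s(p.1, p.2)) 2 hfin
    (himage ▸ hfin.image _) (fun p hp ↦ ⟨p.1, p.2, rfl, hp⟩) ?_
  rintro _ ⟨x, y, rfl, h⟩
  have hne : x ≠ y := fun e ↦ hirr y (e ▸ h)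
  rw [← ncard_pair (a := (x, y)) (b := (y, x)) (by simp [hne])]
  congr 1
  ext ⟨a, b⟩
  simp only [mem_ofPred_eq, Sym2.eq_iff, mem_insert_iff, mem_singleton_iff, Prod.mk.injEq]
  constructor
  · exact And.right
  · rintro (⟨rfl, rfl⟩ | ⟨rfl, rfl⟩)
    exacts [⟨h, Or.inl ⟨rfl, rfl⟩⟩, ⟨hsymm _ _ h, Or.inr ⟨rfl, rfl⟩⟩]

/-- Double counting of the values `f X Y a` over the unordered `R`-pairs `{X, Y}` in both
orientations, when these two orientations always give different values. -/
lemma ncard_unordered_mul_eq {β ι γ : Type*} {R : β → β → Prop} {A : Set ι} {T : Set γ}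
    (f : β → β → ι → γ) (K : ℕ) (hfin : {p : β × β | R p.1 p.2}.Finite) (hA : A.Finite)
    (hT : T.Finite) (hsymm : ∀ X Y, R X Y → R Y X) (hirr : ∀ X, ¬ R X X)
    (hf : ∀ X Y, R X Y → ∀ a ∈ A, f X Y a ∈ T)
    (hne : ∀ X Y, R X Y → ∀ a ∈ A, f X Y a ≠ f Y X a)
    (hK : ∀ c ∈ T, {q : Sym2 β × ι | q.2 ∈ A ∧
      ∃ X Y, q.1 = s(X, Y) ∧ R X Y ∧ f X Y q.2 = c}.ncard = K) :
    {σ : Sym2 β | ∃ X Y, σ = s(X, Y) ∧ R X Y}.ncard * 2 * A.ncard = T.ncard * K := by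
  rw [← ncard_ordered_eq_two_mul hfin hsymm hirr, ← ncard_prod]
  refine ncard_eq_ncard_mul_of_fiber (fun p ↦ f p.1.1 p.1.2 p.2) K (hfin.prod hA) hT
    (fun p hp ↦ hf _ _ hp.1 _ hp.2) fun c hc ↦ ?_
  rw [← hK c hc]
  refine ncard_congr (fun p _ ↦ (s(p.1.1, p.1.2), p.2)) ?_ ?_ ?_
  · rintro ⟨⟨X, Y⟩, a⟩ ⟨⟨hR, ha⟩, hc⟩
    exact ⟨ha, X, Y, rfl, hR, hc⟩
  · rintro ⟨⟨X, Y⟩, a⟩ ⟨⟨X', Y'⟩, a'⟩ ⟨⟨hR, ha⟩, h⟩ ⟨_, h'⟩ heq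
    simp only [Prod.mk.injEq, Sym2.eq_iff] at heq
    obtain ⟨⟨rfl, rfl⟩ | ⟨rfl, rfl⟩, rfl⟩ := heq
    · rfl
    · exact absurd (h.trans h'.symm) (hne _ _ hR _ ha)
  · rintro ⟨σ, a⟩ ⟨ha, X, Y, rfl, hR, hc⟩
    exact ⟨((X, Y), a), ⟨⟨hR, ha⟩, hc⟩, rfl⟩

lemma cyclicDist_comm (n : ℕ) (a b : ℝ) : cyclicDist n a b = cyclicDist n b a := by
  simp only [cyclicDist, abs_sub_comm]

lemma finite_Ln (n : ℕ) : (Ln n).Finite := by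
  refine ((finite_Icc 1 (n ^ (2 * n))).image fun k : ℕ ↦ (k : ℝ) / (n : ℝ) ^ n).subset ?_
  rintro a ⟨k, h1, h2, rfl⟩
  exact ⟨k, ⟨h1, h2⟩, rfl⟩

lemma finite_Mn (n : ℕ) : (Mn n).Finite :=
  (Finite.pi' fun _ ↦ finite_Ln n).subset fun _ hx ↦ hx

lemma IsPair.symm {n : ℕ} {t : ℤ} {m : ℕ} {x y : Fin (n ^ n) → ℝ} (h : IsPair n t m x y) :
    IsPair n t m y x := by
  obtain ⟨hx, hy, hd, hc⟩ := h
  refine ⟨hy, hx, fun i hi ↦ ?_, ?_⟩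
  · rw [cyclicDist_comm, hd i hi.symm]
  · simpa only [ne_comm] using hc

lemma IsPair.ne {n : ℕ} (hn : 0 < n) {t : ℤ} {m : ℕ} {x y : Fin (n ^ n) → ℝ}
    (h : IsPair n t m x y) : x ≠ y := by
  rintro rfl
  have := h.2.2.2
  simp only [ne_eq, not_true_eq_false, ofPred_false, ncard_empty] at this
  exact (pow_pos hn m).ne this

lemma finite_isPair (n : ℕ) (t : ℤ) (m : ℕ) :
    {p : (Fin (n ^ n) → ℝ) × (Fin (n ^ n) → ℝ) | IsPair n t m p.1 p.2}.Finite :=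
  ((finite_Mn n).prod (finite_Mn n)).subset fun _ hp ↦ ⟨hp.1, hp.2.1⟩

lemma ncard_isPair {n : ℕ} (hn : 0 < n) (t : ℤ) (m : ℕ) :
    {p : (Fin (n ^ n) → ℝ) × (Fin (n ^ n) → ℝ) | IsPair n t m p.1 p.2}.ncard =
      pairCount n t m * 2 :=
  ncard_ordered_eq_two_mul (finite_isPair n t m) (fun _ _ h ↦ h.symm) fun _ h ↦ h.ne hn rfl

lemma IsSimplex.symm {n : ℕ} {t : ℤ} {m : ℕ} {X Y : Fin n → Fin (n ^ n) → ℝ}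
    (h : IsSimplex n t m X Y) : IsSimplex n t m Y X :=
  ⟨fun i j ↦ (h.1 j i).symm, h.2.2, h.2.1⟩

lemma IsSimplex.apply_ne {n : ℕ} {t : ℤ} {m : ℕ} {X Y : Fin n → Fin (n ^ n) → ℝ}
    (h : IsSimplex n t m X Y) (i : Fin n) : X i ≠ Y i :=
  (h.1 i i).ne i.pos

lemma not_isSimplex_self {n : ℕ} (hn : 0 < n) (t : ℤ) (m : ℕ) (X : Fin n → Fin (n ^ n) → ℝ) :
    ¬ IsSimplex n t m X X :=
  fun h ↦ h.apply_ne ⟨0, hn⟩ rfl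

lemma finite_isSimplex (n : ℕ) (t : ℤ) (m : ℕ) :
    {p : (Fin n → Fin (n ^ n) → ℝ) × (Fin n → Fin (n ^ n) → ℝ) |
      IsSimplex n t m p.1 p.2}.Finite := by
  have hpi : {X : Fin n → Fin (n ^ n) → ℝ | ∀ i, X i ∈ Mn n}.Finite :=
    Finite.pi' fun _ ↦ finite_Mn n
  exact (hpi.prod hpi).subset fun p hp ↦ ⟨fun i ↦ (hp.1 i i).1, fun i ↦ (hp.1 i i).2.1⟩

lemma simplexCount_mul_eq_of_edge {n : ℕ} (hn : 0 < n) (t : ℤ) (m K : ℕ)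
    (hK : ∀ x y, IsPair n (t + 1) m x y → edgeOccCount n t m x y = K) :
    simplexCount n t m * (n * (n - 1)) = pairCount n (t + 1) m * K := by
  have hcard : {a : Fin n × Fin n | a.1 ≠ a.2}.ncard = n * (n - 1) := by
    have : {a : Fin n × Fin n | a.1 ≠ a.2} = ((Finset.univ : Finset (Fin n)).offDiag : Set _) := by
      ext; simp
    rw [this, ncard_coe_finset, Finset.offDiag_card, Finset.card_univ, Fintype.card_fin,
      Nat.mul_sub_one]
  have key := ncard_unordered_mul_eq (R := IsSimplex n t m)
    (A := {a : Fin n × Fin n | a.1 ≠ a.2}) (T := {p | IsPair n (t + 1) m p.1 p.2})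
    (fun X _ a ↦ (X a.1, X a.2)) K (finite_isSimplex n t m) (toFinite _)
    (finite_isPair n (t + 1) m) (fun _ _ h ↦ h.symm) (not_isSimplex_self hn t m)
    (fun _ _ h a ha ↦ h.2.1 a.1 a.2 ha)
    (fun _ _ h a _ e ↦ h.apply_ne a.1 (congrArg Prod.fst e)) ?_
  · rw [ncard_isPair hn, hcard] at key
    change simplexCount n t m * 2 * _ = _ at key
    linarith
  · rintro ⟨x, y⟩ hxy
    rw [← hK x y hxy, edgeOccCount]
    congr 1
    ext ⟨σ, i, j⟩
    simp only [mem_ofPred_eq, Prod.mk.injEq]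
    refine and_congr_right fun _ ↦ ⟨?_, ?_⟩
    · rintro ⟨X, Y, hσ, hS, h⟩
      exact ⟨X, Y, hσ, hS, Or.inl h⟩
    · rintro ⟨X, Y, hσ, hS, h | h⟩
      exacts [⟨X, Y, hσ, hS, h⟩, ⟨Y, X, hσ.trans Sym2.eq_swap, hS.symm, h⟩]

lemma simplexCount_mul_eq_of_line {n : ℕ} (hn : 0 < n) (t : ℤ) (m L : ℕ)
    (hL : ∀ x y, IsPair n t (m + 1) x y → lineOccCount n t m x y = L) :
    simplexCount n t m * n ^ 2 = pairCount n t (m + 1) * L := by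
  have key := ncard_unordered_mul_eq (R := IsSimplex n t m)
    (A := (univ : Set (Fin n × Fin n))) (T := {p | IsPair n t (m + 1) p.1 p.2})
    (fun X Y a ↦ (X a.1, Y a.2)) L (finite_isSimplex n t m) (toFinite _)
    (finite_isPair n t (m + 1)) (fun _ _ h ↦ h.symm) (not_isSimplex_self hn t m)
    (fun _ _ h a _ ↦ h.1 a.1 a.2)
    (fun _ _ h a _ e ↦ h.apply_ne a.1 (congrArg Prod.fst e)) ?_
  · rw [ncard_isPair hn, ncard_univ, Nat.card_prod, Nat.card_fin] at key
    change simplexCount n t m * 2 * _ = _ at key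
    linarith
  · rintro ⟨x, y⟩ hxy
    rw [← hL x y hxy, lineOccCount]
    simp only [mem_univ, true_and, Prod.mk.injEq]

end

/-- the double counting identities
`S_{(t,m)}·n(n−1) = N_{(t+1,m)}·K_{(t+1,m)}`, `S_{(t,m)}·n² = N_{(t,m+1)}·L_{(t,m+1)}`
and `L_{(t,m+1)}·(n−1)·N_{(t,m+1)} = K_{(t+1,m)}·n·N_{(t+1,m)}`, where `K_{(t+1,m)}`
(resp. `L_{(t,m+1)}`) is the common number of ways any fixed `(t+1,m)`-pair
(resp. `(t,m+1)`-pair) occurs as an edge (resp. connecting line) of a `(t,m)`-simplex. -/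
theorem simplex_counting (n : ℕ) (hn : 0 < n) (hne : Even n) (m : ℕ) (hm0 : 0 < m)
    (hmn : m < n - 1) (t : ℤ) (ht1 : -(n : ℤ) < t) (ht2 : t < (n : ℤ) - 1)
    (K L : ℕ)
    (hK : ∀ x y, IsPair n (t + 1) m x y → edgeOccCount n t m x y = K)
    (hL : ∀ x y, IsPair n t (m + 1) x y → lineOccCount n t m x y = L) :
    simplexCount n t m * (n * (n - 1)) = pairCount n (t + 1) m * K ∧
    simplexCount n t m * n ^ 2 = pairCount n t (m + 1) * L ∧
    L * (n - 1) * pairCount n t (m + 1) = K * n * pairCount n (t + 1) m := by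
  have hE := simplexCount_mul_eq_of_edge hn t m K hK
  have hC := simplexCount_mul_eq_of_line hn t m L hL
  refine ⟨hE, hC, ?_⟩
  calc L * (n - 1) * pairCount n t (m + 1)
      = (pairCount n t (m + 1) * L) * (n - 1) := by ring
    _ = simplexCount n t m * (n * (n - 1)) * n := by rw [← hC]; ring
    _ = K * n * pairCount n (t + 1) m := by rw [hE]; ring
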